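/- For constrained-degree percolation on ℤ^d, d ≥ 2, with κ ∈ {2,…,2d}: for every fixed n ≥ 1, only finitely many edges e ∈ 𝓔 have ℙ(e is p-pivotal for E_n(p)) > 0, and the function p ↦ Σ_{e∈𝓔} ℙ(e is p-pivotal for E_n(p)) is continuous on [0,1). -/

import Mathlib

open MeasureTheory

namespace CDP

/-- Vertices of the hypercubic lattice `ℤ^d`. -/
abbrev Vertex (d : ℕ) := Fin d → ℤ

/-- Nearest-neighbour adjacency in `ℤ^d`. -/
def adj {d : ℕ} (x y : Vertex d) : Prop := (∑ i, |x i - y i|) = 1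

/-- `e` is a nearest-neighbour (non-oriented) edge of `ℤ^d`, i.e. an element of `𝓔`. -/
def IsNNEdge {d : ℕ} (e : Sym2 (Vertex d)) : Prop := ∃ x y, adj x y ∧ e = s(x, y)

/-- Configurations: labels attached to (unordered) pairs of vertices; only the labels of
nearest-neighbour edges (elements of `𝓔`) are ever relevant. -/
abbrev Config (d : ℕ) := Sym2 (Vertex d) → ℝ

/-- `ℓ^1` norm of a vertex. -/
def norm1 {d : ℕ} (x : Vertex d) : ℤ := ∑ i, |x i|

/-- The set `Ω`: configurations with values in `[0,1]`, pairwise distinct coordinates on `𝓔`,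
and no infinite walk along which the labels are strictly monotone. -/
def goodConfigs (d : ℕ) : Set (Config d) :=
  {U | (∀ e, IsNNEdge e → U e ∈ Set.Icc (0 : ℝ) 1) ∧
    (∀ e f, IsNNEdge e → IsNNEdge f → U e = U f → e = f) ∧
    ¬ ∃ w : ℕ → Vertex d, (∀ i, adj (w i) (w (i + 1))) ∧
      (StrictMono (fun i => U s(w i, w (i + 1))) ∨ StrictAnti (fun i => U s(w i, w (i + 1))))}

/-- A labelling `σ` of the edges by "ever opens" which is consistent with the
constrained-degree dynamics driven by `U`: an edge (attempting to open at time `U e`)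
opens iff at that moment both of its end-vertices have degree `< κ` among the
previously opened edges. -/
def Consistent {d : ℕ} (κ : ℕ) (U : Config d) (σ : Sym2 (Vertex d) → Prop) : Prop :=
  ∀ e, IsNNEdge e →
    (σ e ↔ ∀ v ∈ e,
      Set.ncard {f : Sym2 (Vertex d) | IsNNEdge f ∧ v ∈ f ∧ f ≠ e ∧ U f < U e ∧ σ f} < κ)

/-- `ω_p(U, e) = 1`, i.e. the edge `e` is `p`-open in the constrained-degree percolation
process with constraint `κ` driven by `U`. -/
def openEdge {d : ℕ} (κ : ℕ) (U : Config d) (p : ℝ) (e : Sym2 (Vertex d)) : Prop :=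
  IsNNEdge e ∧ U e ≤ p ∧ ∃ σ, Consistent κ U σ ∧ σ e

/-- `x 0, …, x k` is a path: consecutive vertices adjacent, all vertices distinct. -/
def IsPathOn {d : ℕ} (k : ℕ) (x : ℕ → Vertex d) : Prop :=
  (∀ i < k, adj (x i) (x (i + 1))) ∧ ∀ i ≤ k, ∀ j ≤ k, x i = x j → i = j

/-- The modified one-arm event `E_n(p)`: a path `x_0, …, x_k` with `‖x_0‖₁ = n`,
`‖x_i‖₁ < n` for `1 ≤ i ≤ k`, `x_k = 0`, whose head consists of `p`-open edges and whose
tail is decreasing (values `≤ p`, strictly decreasing towards the origin). -/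
def modifiedOneArm {d : ℕ} (κ n : ℕ) (p : ℝ) (U : Config d) : Prop :=
  ∃ (k : ℕ) (x : ℕ → Vertex d),
    IsPathOn k x ∧ norm1 (x 0) = (n : ℤ) ∧ (∀ i, 1 ≤ i → i ≤ k → norm1 (x i) < (n : ℤ)) ∧
    x k = 0 ∧
    ∃ l ≤ k,
      (∀ i < l, openEdge κ U p s(x i, x (i + 1))) ∧
      (∀ i, l ≤ i → i < k → U s(x i, x (i + 1)) ≤ p) ∧
      (∀ i, l ≤ i → i + 1 < k → U s(x (i + 1), x (i + 2)) < U s(x i, x (i + 1)))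

/-- `a` and `b` are connected by a `p`-open path. -/
def openConn {d : ℕ} (κ : ℕ) (U : Config d) (p : ℝ) (a b : Vertex d) : Prop :=
  ∃ (k : ℕ) (x : ℕ → Vertex d), IsPathOn k x ∧ x 0 = a ∧ x k = b ∧
    ∀ i < k, openEdge κ U p s(x i, x (i + 1))

/-- There is an infinite `p`-open path starting at the origin. -/
def zeroToInf {d : ℕ} (κ : ℕ) (U : Config d) (p : ℝ) : Prop :=
  ∃ x : ℕ → Vertex d, x 0 = 0 ∧ (∀ i, adj (x i) (x (i + 1))) ∧ Function.Injective x ∧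
    ∀ i, openEdge κ U p s(x i, x (i + 1))

/-- `P` is the law of i.i.d. `Uniform[0,1]` labels: a probability measure whose
finite-dimensional cylinder probabilities are products of uniform probabilities. -/
def IsProductUniform {d : ℕ} (P : Measure (Config d)) : Prop :=
  IsProbabilityMeasure P ∧
    ∀ (s : Finset (Sym2 (Vertex d))) (f : Sym2 (Vertex d) → Set ℝ),
      (∀ e ∈ s, MeasurableSet (f e)) →
      P {U | ∀ e ∈ s, U e ∈ f e} = ∏ e ∈ s, volume (f e ∩ Set.Icc 0 1)

/-- The one-arm probability `θ_n(p)`. -/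
noncomputable def theta {d : ℕ} (κ : ℕ) (P : Measure (Config d)) (n : ℕ) (p : ℝ) : ℝ :=
  (P {U | U ∈ goodConfigs d ∧ ∃ b, norm1 b = (n : ℤ) ∧ openConn κ U p 0 b}).toReal

/-- `θ(p) = ℙ(0 ↔ ∞)`. -/
noncomputable def thetaInf {d : ℕ} (κ : ℕ) (P : Measure (Config d)) (p : ℝ) : ℝ :=
  (P {U | U ∈ goodConfigs d ∧ zeroToInf κ U p}).toReal

/-- The critical point `p_c`. -/
noncomputable def pc {d : ℕ} (κ : ℕ) (P : Measure (Config d)) : ℝ :=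
  sSup {p : ℝ | p ∈ Set.Icc (0 : ℝ) 1 ∧ thetaInf κ P p = 0}

/-- The modified one-arm probability `τ_n(p)`. -/
noncomputable def tau {d : ℕ} (κ : ℕ) (P : Measure (Config d)) (n : ℕ) (p : ℝ) : ℝ :=
  (P {U | U ∈ goodConfigs d ∧ modifiedOneArm κ n p U}).toReal

/-- `e` is `p`-pivotal for `E_n(p)` at `U`. -/
def pPivotal {d : ℕ} (κ n : ℕ) (p : ℝ) (e : Sym2 (Vertex d)) (U : Config d) : Prop :=
  U ∈ goodConfigs d ∧ p < U e ∧ Function.update U e p ∈ goodConfigs d ∧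
    ¬ (modifiedOneArm κ n p U ↔ modifiedOneArm κ n p (Function.update U e p))

/-- `e` is `U`-pivotal for `E_n(p)` at `U`. -/
def uPivotal {d : ℕ} (κ n : ℕ) (p : ℝ) (e : Sym2 (Vertex d)) (U : Config d) : Prop :=
  U ∈ goodConfigs d ∧ ∃ U' ∈ goodConfigs d, (∀ f, f ≠ e → U' f = U f) ∧
    ¬ (modifiedOneArm κ n p U ↔ modifiedOneArm κ n p U')

theorem adj_comm {d : ℕ} {x y : Vertex d} : adj x y ↔ adj y x := by
  simp only [adj, abs_sub_comm]

/-- The nearest-neighbour edges with both end-vertices in the `ℓ^1` ball of radius `m`. -/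
def ballEdges (d m : ℕ) : Set (Sym2 (Vertex d)) :=
  {e | IsNNEdge e ∧ ∀ v ∈ e, norm1 v ≤ (m : ℤ)}

theorem isNNEdge_mk {d : ℕ} {x y : Vertex d} : IsNNEdge s(x, y) ↔ adj x y := by
  constructor
  · rintro ⟨a, b, hab, h⟩
    rcases Sym2.eq_iff.1 h with ⟨rfl, rfl⟩ | ⟨rfl, rfl⟩
    · exact hab
    · exact adj_comm.1 hab
  · exact fun h => ⟨x, y, h, rfl⟩

theorem norm1_le_of_adj {d : ℕ} {x y : Vertex d} (h : adj x y) : norm1 y ≤ norm1 x + 1 := by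
  rw [← h, norm1, norm1, ← Finset.sum_add_distrib]
  refine Finset.sum_le_sum fun i _ => ?_
  rw [abs_sub_comm]
  linarith [abs_sub_abs_le_abs_sub (y i) (x i)]

theorem finite_ball (d m : ℕ) : {x : Vertex d | norm1 x ≤ (m : ℤ)}.Finite := by
  refine (Set.finite_Icc (fun _ => -(m : ℤ)) (fun _ => (m : ℤ))).subset fun x hx => ?_
  have h : ∀ i, |x i| ≤ (m : ℤ) := fun i =>
    (Finset.single_le_sum (f := fun i => |x i|) (fun j _ => abs_nonneg _)
      (Finset.mem_univ i)).trans hx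
  exact ⟨fun i => (abs_le.1 (h i)).1, fun i => (abs_le.1 (h i)).2⟩

theorem finite_ballEdges (d m : ℕ) : (ballEdges d m).Finite := by
  refine (((finite_ball d m).prod (finite_ball d m)).image fun z => s(z.1, z.2)).subset ?_
  rintro e ⟨-, he⟩
  induction e with
  | h x y => exact ⟨(x, y), ⟨he x (by simp), he y (by simp)⟩, rfl⟩

theorem mem_ballEdges_succ {d m : ℕ} {f : Sym2 (Vertex d)} (hf : IsNNEdge f) {v : Vertex d}
    (hv : v ∈ f) (hm : norm1 v ≤ (m : ℤ)) : f ∈ ballEdges d (m + 1) := by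
  refine ⟨hf, fun w hw => ?_⟩
  obtain ⟨u, rfl⟩ := Sym2.mem_iff_exists.1 hv
  have := norm1_le_of_adj (isNNEdge_mk.1 hf)
  push_cast
  rcases Sym2.mem_iff.1 hw with rfl | rfl <;> linarith

theorem norm1_nonneg {d : ℕ} (v : Vertex d) : 0 ≤ norm1 v :=
  Finset.sum_nonneg fun _ _ => abs_nonneg _

theorem finite_incident {d : ℕ} (v : Vertex d) :
    {f : Sym2 (Vertex d) | IsNNEdge f ∧ v ∈ f}.Finite :=
  (finite_ballEdges d ((norm1 v).toNat + 1)).subset fun _ hf =>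
    mem_ballEdges_succ hf.1 hf.2 (Int.toNat_of_nonneg (norm1_nonneg v)).ge

/-- The edge `f` is adjacent to the edge `e` and has a smaller label. -/
def Precedes {d : ℕ} (U : Config d) (f e : Sym2 (Vertex d)) : Prop :=
  IsNNEdge f ∧ IsNNEdge e ∧ U f < U e ∧ ∃ v, v ∈ f ∧ v ∈ e

theorem wellFounded_directed {d : ℕ} {U : Config d} (hU : U ∈ goodConfigs d) :
    WellFounded fun b a : Vertex d × Vertex d =>
      a.2 = b.1 ∧ adj a.1 a.2 ∧ adj b.1 b.2 ∧ U s(b.1, b.2) < U s(a.1, a.2) := by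
  rw [wellFounded_iff_isEmpty_descending_chain]
  refine ⟨fun ⟨a, ha⟩ => hU.2.2 ⟨fun i => (a i).1, fun i => ?_, Or.inr ?_⟩⟩
  · have := ha i
    simpa only [this.1] using this.2.1
  · refine strictAnti_nat_of_succ_lt fun i => ?_
    have h0 := ha i
    have h1 := ha (i + 1)
    simpa only [h0.1, h1.1] using h0.2.2.2

theorem wellFounded_precedes {d : ℕ} {U : Config d} (hU : U ∈ goodConfigs d) :
    WellFounded (Precedes U) := by
  have key : ∀ a : Vertex d × Vertex d, adj a.1 a.2 → ∀ f, IsNNEdge f → a.2 ∈ f →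
      U f < U s(a.1, a.2) → Acc (Precedes U) f := by
    intro a
    induction a using (wellFounded_directed hU).induction with
    | _ a ih =>
      intro ha
      have hfin := finite_incident a.2
      have hwf : WellFounded fun f g : {f : Sym2 (Vertex d) // IsNNEdge f ∧ a.2 ∈ f} =>
          U f.1 < U g.1 := by
        have : Finite {f : Sym2 (Vertex d) // IsNNEdge f ∧ a.2 ∈ f} := hfin.to_subtype
        have : IsTrans {f : Sym2 (Vertex d) // IsNNEdge f ∧ a.2 ∈ f}
          fun f g => U f.1 < U g.1 := ⟨fun _ _ _ => lt_trans⟩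
        have : Std.Irrefl (α := {f : Sym2 (Vertex d) // IsNNEdge f ∧ a.2 ∈ f})
          fun f g => U f.1 < U g.1 := ⟨fun _ => lt_irrefl _⟩
        exact Finite.wellFounded_of_trans_of_irrefl _
      intro f hf hv
      have main : ∀ f : {f : Sym2 (Vertex d) // IsNNEdge f ∧ a.2 ∈ f},
          U f.1 < U s(a.1, a.2) → Acc (Precedes U) f.1 := by
        intro f
        induction f using hwf.induction with
        | _ f ihf =>
          intro hlt
          refine Acc.intro _ fun g hg => ?_
          obtain ⟨hgN, hfN, hgf, v, hvg, hvf⟩ := hg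
          obtain ⟨f, hf1, hf2⟩ := f
          obtain ⟨z, rfl⟩ := Sym2.mem_iff_exists.1 hf2
          rcases Sym2.mem_iff.1 hvf with rfl | rfl
          · exact ihf ⟨g, hgN, hvg⟩ hgf (hgf.trans hlt)
          · exact ih (a.2, v) ⟨rfl, ha, isNNEdge_mk.1 hf1, hlt⟩ (isNNEdge_mk.1 hf1) g hgN hvg hgf
      exact main ⟨f, hf, hv⟩
  refine ⟨fun e => Acc.intro _ fun f ⟨hf, he, hlt, v, hvf, hve⟩ => ?_⟩
  obtain ⟨w, rfl⟩ := Sym2.mem_iff_exists.1 hve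
  rw [Sym2.eq_swap] at hlt
  exact key (w, v) (adj_comm.1 (isNNEdge_mk.1 he)) f hf hvf hlt

theorem exists_consistent {d : ℕ} (κ : ℕ) {U : Config d} (hU : U ∈ goodConfigs d) :
    ∃ σ, Consistent κ U σ := by
  have hwf := wellFounded_precedes hU
  refine ⟨hwf.fix fun e σ => ∀ v ∈ e,
    Set.ncard {f | ∃ h : Precedes U f e, v ∈ f ∧ σ f h} < κ, fun e he => ?_⟩
  rw [hwf.fix_eq]
  refine forall₂_congr fun v hv => ?_
  have : ∀ {s t : Set (Sym2 (Vertex d))}, s = t → (s.ncard < κ ↔ t.ncard < κ) := by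
    rintro s t rfl; rfl
  refine this (Set.ext fun f => ?_)
  constructor
  · rintro ⟨h, hvf, hσ⟩
    exact ⟨h.1, hvf, fun hfe => (hfe ▸ h.2.2.1).false, h.2.2.1, hσ⟩
  · rintro ⟨hf, hvf, -, hlt, hσ⟩
    exact ⟨⟨hf, he, hlt, v, hvf, hv⟩, hvf, hσ⟩

/-- Two configurations that agree on labels below `t` drive the same dynamics before time `t`. -/
theorem Consistent.iff_of_agree_below {d κ : ℕ} {U V : Config d} {σ τ : Sym2 (Vertex d) → Prop}
    (hU : U ∈ goodConfigs d) (hσ : Consistent κ U σ) (hτ : Consistent κ V τ) {t : ℝ}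
    (hUV : ∀ f, IsNNEdge f → U f < t ∧ V f = U f ∨ t ≤ U f ∧ t ≤ V f)
    (f : Sym2 (Vertex d)) (hf : IsNNEdge f) (hft : U f < t) : σ f ↔ τ f := by
  induction f using (wellFounded_precedes hU).induction with
  | _ f ih =>
    rw [hσ f hf, hτ f hf]
    refine forall₂_congr fun v hv => ?_
    have hVf : V f = U f := by grind
    have : {g | IsNNEdge g ∧ v ∈ g ∧ g ≠ f ∧ U g < U f ∧ σ g} =
        {g | IsNNEdge g ∧ v ∈ g ∧ g ≠ f ∧ V g < V f ∧ τ g} := by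
      ext g
      refine and_congr_right fun hg => and_congr_right fun hvg => and_congr_right fun _ => ?_
      have hlt : U g < U f ↔ V g < V f := by grind
      rw [← hlt]
      exact and_congr_right fun h => ih g ⟨hg, hf, h, v, hvg, hv⟩ hg (h.trans hft)
    rw [this]

theorem openEdge_iff {d κ : ℕ} {U : Config d} {σ : Sym2 (Vertex d) → Prop}
    (hU : U ∈ goodConfigs d) (hσ : Consistent κ U σ) {p : ℝ} {e : Sym2 (Vertex d)}
    (he : IsNNEdge e) : openEdge κ U p e ↔ U e ≤ p ∧ σ e := by
  refine ⟨fun ⟨_, hp, τ, hτ, hτe⟩ => ⟨hp, ?_⟩, fun h => ⟨he, h.1, σ, hσ, h.2⟩⟩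
  exact (hσ.iff_of_agree_below (t := U e + 1) hU hτ (fun f _ => by grind) e he (by simp)).2 hτe

/-- Lowering the label of `e` to `p` does not change the dynamics before time `p`. -/
theorem Consistent.iff_of_update {d κ : ℕ} {U : Config d} {σ τ : Sym2 (Vertex d) → Prop}
    {p : ℝ} {e : Sym2 (Vertex d)} (hU : U ∈ goodConfigs d) (hσ : Consistent κ U σ)
    (hτ : Consistent κ (Function.update U e p) τ) (hpe : p < U e)
    {f : Sym2 (Vertex d)} (hf : IsNNEdge f) (hfp : U f < p) : σ f ↔ τ f := by
  refine hσ.iff_of_agree_below hU hτ (t := p) (fun g _ => ?_) f hf hfp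
  by_cases hg : g = e
  · subst hg; simp [hpe.le]
  · simp only [Function.update_of_ne hg]
    grind

theorem openEdge_update_iff {d κ : ℕ} {U : Config d} {p : ℝ} {e f : Sym2 (Vertex d)}
    (he : IsNNEdge e) (hU : U ∈ goodConfigs d) (hU' : Function.update U e p ∈ goodConfigs d)
    (hpe : p < U e) (hf : IsNNEdge f) (hfe : f ≠ e) :
    openEdge κ (Function.update U e p) p f ↔ openEdge κ U p f := by
  obtain ⟨σ, hσ⟩ := exists_consistent κ hU
  obtain ⟨τ, hτ⟩ := exists_consistent κ hU'
  rw [openEdge_iff hU hσ hf, openEdge_iff hU' hτ hf, Function.update_of_ne hfe]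
  refine and_congr_right fun hle => (hσ.iff_of_update hU hτ hpe hf (hle.lt_of_ne ?_)).symm
  intro h
  exact hfe (hU'.2.1 f e hf he (by simp [Function.update_of_ne hfe, h]))

theorem openEdge_update_self_iff {d κ : ℕ} {U : Config d} {p : ℝ} {e : Sym2 (Vertex d)}
    {σ : Sym2 (Vertex d) → Prop} (he : IsNNEdge e) (hU : U ∈ goodConfigs d)
    (hσ : Consistent κ U σ) (hU' : Function.update U e p ∈ goodConfigs d) (hpe : p < U e) :
    openEdge κ (Function.update U e p) p e ↔
      ∀ v ∈ e, Set.ncard {f | IsNNEdge f ∧ v ∈ f ∧ f ≠ e ∧ U f < p ∧ σ f} < κ := by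
  obtain ⟨τ, hτ⟩ := exists_consistent κ hU'
  rw [openEdge_iff hU' hτ he, hτ e he, Function.update_self]
  simp only [le_refl, true_and]
  refine forall₂_congr fun v hv => ?_
  have : {f | IsNNEdge f ∧ v ∈ f ∧ f ≠ e ∧ Function.update U e p f < p ∧ τ f} =
      {f | IsNNEdge f ∧ v ∈ f ∧ f ≠ e ∧ U f < p ∧ σ f} := by
    ext f
    refine and_congr_right fun hf => and_congr_right fun _ => and_congr_right fun hfe => ?_
    rw [Function.update_of_ne hfe]
    exact and_congr_right fun h => (hσ.iff_of_update hU hτ hpe hf h).symm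
  rw [this]

theorem modifiedOneArm_mono {d κ n : ℕ} {U V : Config d} {p q : ℝ}
    (hopen : ∀ f ∈ ballEdges d n, openEdge κ U p f → openEdge κ V q f)
    (hle : ∀ f ∈ ballEdges d n, U f ≤ p → V f ≤ q)
    (hlt : ∀ f ∈ ballEdges d n, ∀ g ∈ ballEdges d n, U f < U g → V f < V g)
    (h : modifiedOneArm κ n p U) : modifiedOneArm κ n q V := by
  obtain ⟨k, x, hx, h0, hn, hk, l, hl, h1, h2, h3⟩ := h
  have hnorm : ∀ i ≤ k, norm1 (x i) ≤ (n : ℤ) := fun i hi => by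
    rcases Nat.eq_zero_or_pos i with rfl | hpos
    · exact h0.le
    · exact (hn i hpos hi).le
  have hmem : ∀ i < k, s(x i, x (i + 1)) ∈ ballEdges d n := fun i hi => by
    refine ⟨isNNEdge_mk.2 (hx.1 i hi), fun v hv => ?_⟩
    rcases Sym2.mem_iff.1 hv with rfl | rfl
    · exact hnorm i hi.le
    · exact hnorm (i + 1) hi
  exact ⟨k, x, hx, h0, hn, hk, l, hl, fun i hi => hopen _ (hmem i (hi.trans_le hl)) (h1 i hi),
    fun i hi hik => hle _ (hmem i hik) (h2 i hi hik),
    fun i hi hik => hlt _ (hmem (i + 1) hik) _ (hmem i (by omega)) (h3 i hi hik)⟩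

theorem modifiedOneArm_congr {d κ n : ℕ} {U V : Config d} {p q : ℝ}
    (hopen : ∀ f ∈ ballEdges d n, openEdge κ U p f ↔ openEdge κ V q f)
    (hle : ∀ f ∈ ballEdges d n, U f ≤ p ↔ V f ≤ q)
    (hlt : ∀ f ∈ ballEdges d n, ∀ g ∈ ballEdges d n, U f < U g ↔ V f < V g) :
    modifiedOneArm κ n p U ↔ modifiedOneArm κ n q V :=
  ⟨modifiedOneArm_mono (fun f hf => (hopen f hf).1) (fun f hf => (hle f hf).1)
    fun f hf g hg => (hlt f hf g hg).1,
   modifiedOneArm_mono (fun f hf => (hopen f hf).2) (fun f hf => (hle f hf).2)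
    fun f hf g hg => (hlt f hf g hg).2⟩

theorem pPivotal.mem_ballEdges {d κ n : ℕ} {p : ℝ} {e : Sym2 (Vertex d)} {U : Config d}
    (he : IsNNEdge e) (h : pPivotal κ n p e U) : e ∈ ballEdges d n := by
  obtain ⟨hU, hpe, hU', hne⟩ := h
  by_contra hmem
  have hfe : ∀ f ∈ ballEdges d n, f ≠ e := fun f hf hfe => hmem (hfe ▸ hf)
  refine hne (modifiedOneArm_congr (fun f hf => ?_) (fun f hf => ?_) fun f hf g hg => ?_)
  · exact (openEdge_update_iff he hU hU' hpe hf.1 (hfe f hf)).symm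
  · rw [Function.update_of_ne (hfe f hf)]
  · rw [Function.update_of_ne (hfe f hf), Function.update_of_ne (hfe g hg)]

theorem update_mem_goodConfigs {d : ℕ} {U : Config d} {e : Sym2 (Vertex d)} {q : ℝ}
    (hU : U ∈ goodConfigs d) (hq : q ∈ Set.Icc (0 : ℝ) 1) (hne : ∀ f, IsNNEdge f → U f ≠ q) :
    Function.update U e q ∈ goodConfigs d := by
  refine ⟨fun f hf => ?_, fun f g hf hg hfg => ?_, ?_⟩
  · by_cases hfe : f = e
    · subst hfe; simpa using hq
    · simpa [Function.update_of_ne hfe] using hU.1 f hf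
  · have h1 := hne f hf
    have h2 := hne g hg
    have h3 := hU.2.1 f g hf hg
    simp only [Function.update_apply] at hfg
    grind
  · rintro ⟨w, hw, hmono⟩
    have hinj : Function.Injective fun i => Function.update U e q s(w i, w (i + 1)) := by
      rcases hmono with h | h
      · exact h.injective
      · exact h.injective
    obtain ⟨N, hN⟩ : ∃ N, ∀ i ≥ N, s(w i, w (i + 1)) ≠ e := by
      by_cases hex : ∃ j, s(w j, w (j + 1)) = e
      · obtain ⟨j, hj⟩ := hex
        refine ⟨j + 1, fun i hi h => ?_⟩
        have : i = j := hinj (by simp only [h, hj])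
        omega
      · exact ⟨0, fun i _ h => hex ⟨i, h⟩⟩
    have heq : ∀ i, Function.update U e q s(w (i + N), w (i + N + 1)) =
        U s(w (i + N), w (i + N + 1)) := fun i => Function.update_of_ne (hN _ (by omega)) _ _
    refine hU.2.2 ⟨fun i => w (i + N), fun i => ?_, ?_⟩
    · simpa only [Nat.add_right_comm _ 1 N] using hw (i + N)
    · simp only [Nat.add_right_comm _ 1 N, ← heq]
      refine hmono.imp (fun h i j hij => ?_) fun h i j hij => ?_
      · exact h (Nat.add_lt_add_right hij N)
      · exact h (Nat.add_lt_add_right hij N)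

theorem pPivotal.of_lt_iff_lt {d κ n : ℕ} {p q : ℝ} {e : Sym2 (Vertex d)} {U : Config d}
    (he : IsNNEdge e) (h : pPivotal κ n p e U) (hq : q ∈ Set.Icc (0 : ℝ) 1)
    (hne : ∀ f, IsNNEdge f → U f ≠ q)
    (hpq : ∀ f ∈ ballEdges d (n + 1), U f < p ↔ U f < q) : pPivotal κ n q e U := by
  have hen := h.mem_ballEdges he
  obtain ⟨hU, hpe, hUp, hiff⟩ := h
  have hUq := update_mem_goodConfigs (e := e) hU hq hne
  have hsub : ∀ f ∈ ballEdges d n, f ∈ ballEdges d (n + 1) := fun f hf =>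
    ⟨hf.1, fun v hv => by have := hf.2 v hv; push_cast; linarith⟩
  have hnp : ∀ f, IsNNEdge f → U f ≠ p := by
    intro f hf hfp
    by_cases hfe : f = e
    · exact hpe.ne' (hfe ▸ hfp)
    · exact hfe (hUp.2.1 f e hf he (by simp [Function.update_of_ne hfe, hfp]))
  have hle : ∀ f ∈ ballEdges d n, U f ≤ p ↔ U f ≤ q := by
    intro f hf
    rw [(hnp f hf.1).le_iff_lt, (hne f hf.1).le_iff_lt, hpq f (hsub f hf)]
  have hqe : q < U e := lt_of_not_ge fun h => hpe.not_ge ((hle e hen).2 h)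
  obtain ⟨σ, hσ⟩ := exists_consistent κ hU
  have hopen : ∀ f ∈ ballEdges d n, openEdge κ U p f ↔ openEdge κ U q f := fun f hf => by
    rw [openEdge_iff hU hσ hf.1, openEdge_iff hU hσ hf.1, hle f hf]
  refine ⟨hU, hqe, hUq, ?_⟩
  rw [modifiedOneArm_congr hopen hle fun _ _ _ _ => Iff.rfl] at hiff
  rwa [← modifiedOneArm_congr (U := Function.update U e p) (V := Function.update U e q) (p := p)]
  · intro f hf
    by_cases hfe : f = e
    · subst hfe
      rw [openEdge_update_self_iff he hU hσ hUp hpe, openEdge_update_self_iff he hU hσ hUq hqe]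
      refine forall₂_congr fun v hv => ?_
      have : {g | IsNNEdge g ∧ v ∈ g ∧ g ≠ f ∧ U g < p ∧ σ g} =
          {g | IsNNEdge g ∧ v ∈ g ∧ g ≠ f ∧ U g < q ∧ σ g} := by
        ext g
        refine and_congr_right fun hg => and_congr_right fun hvg => and_congr_right fun _ => ?_
        rw [hpq g (mem_ballEdges_succ hg hvg (hf.2 v hv))]
      rw [this]
    · rw [openEdge_update_iff he hU hUp hpe hf.1 hfe, openEdge_update_iff he hU hUq hqe hf.1 hfe,
        hopen f hf]
  · intro f hf
    by_cases hfe : f = e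
    · subst hfe; simp
    · simpa only [Function.update_of_ne hfe] using hle f hf
  · intro f hf g hg
    have := hpq f (hsub f hf)
    have := hle g hg
    have := hnp g hg.1
    have := hne g hg.1
    simp only [Function.update_apply]
    grind

theorem IsProductUniform.measure_mem {d : ℕ} {P : Measure (Config d)} (hP : IsProductUniform P)
    (f : Sym2 (Vertex d)) {s : Set ℝ} (hs : MeasurableSet s) :
    P {U | U f ∈ s} = volume (s ∩ Set.Icc 0 1) := by
  simpa using hP.2 {f} (fun _ => s) fun _ _ => hs

theorem IsProductUniform.measure_not_lt_iff_lt_le {d : ℕ} {P : Measure (Config d)}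
    (hP : IsProductUniform P) (f : Sym2 (Vertex d)) (p q : ℝ) :
    P {U | ¬(U f < p ↔ U f < q)} ≤ ENNReal.ofReal |p - q| := by
  have hsub : {U : Config d | ¬(U f < p ↔ U f < q)} ⊆ {U | U f ∈ Set.uIcc p q} := by
    intro U hU
    simp only [Set.mem_ofPred_eq, Set.mem_uIcc] at hU ⊢
    grind
  refine (measure_mono hsub).trans ?_
  rw [hP.measure_mem f measurableSet_uIcc]
  refine (measure_mono Set.inter_subset_left).trans ?_
  rw [Real.volume_interval, abs_sub_comm]

theorem IsProductUniform.measure_exists_eq {d : ℕ} {P : Measure (Config d)}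
    (hP : IsProductUniform P) (q : ℝ) : P {U | ∃ f, IsNNEdge f ∧ U f = q} = 0 := by
  have : Countable (Sym2 (Vertex d)) := Quotient.countable
  refine measure_mono_null (t := ⋃ f : Sym2 (Vertex d), {U : Config d | U f ∈ ({q} : Set ℝ)})
    (fun U ⟨f, _, hf⟩ => Set.mem_iUnion.2 ⟨f, hf⟩) ?_
  refine measure_iUnion_null fun f => ?_
  rw [hP.measure_mem f (measurableSet_singleton q)]
  exact measure_mono_null Set.inter_subset_left (by simp)

theorem measure_pPivotal_le {d κ n : ℕ} {P : Measure (Config d)} (hP : IsProductUniform P)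
    {e : Sym2 (Vertex d)} (he : IsNNEdge e) (p : ℝ) {q : ℝ} (hq : q ∈ Set.Icc (0 : ℝ) 1) :
    P {U | pPivotal κ n p e U} ≤ P {U | pPivotal κ n q e U} +
      ((ballEdges d (n + 1)).ncard : ENNReal) * ENNReal.ofReal |p - q| := by
  have hfin := finite_ballEdges d (n + 1)
  set F := hfin.toFinset
  have hsub : {U | pPivotal κ n p e U} ⊆ {U | pPivotal κ n q e U} ∪
      ((⋃ f ∈ F, {U : Config d | ¬(U f < p ↔ U f < q)}) ∪ {U | ∃ f, IsNNEdge f ∧ U f = q}) := by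
    intro U hU
    by_contra hcon
    simp only [Set.mem_union, Set.mem_iUnion, Set.mem_ofPred_eq, not_or, not_exists, not_not,
      not_and] at hcon
    exact hcon.1 (hU.of_lt_iff_lt he hq hcon.2.2 fun f hf =>
      hcon.2.1 f (hfin.mem_toFinset.2 hf))
  refine (measure_mono hsub).trans ((measure_union_le _ _).trans ?_)
  gcongr
  refine (measure_union_le _ _).trans ?_
  rw [hP.measure_exists_eq, add_zero]
  refine (measure_biUnion_finset_le _ _).trans ?_
  refine (Finset.sum_le_card_nsmul _ _ _ fun f _ => hP.measure_not_lt_iff_lt_le f p q).trans ?_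
  rw [nsmul_eq_mul, Set.ncard_eq_toFinset_card _ hfin]

theorem lipschitzOnWith_measure_pPivotal {d : ℕ} (κ n : ℕ) {P : Measure (Config d)}
    (hP : IsProductUniform P) {e : Sym2 (Vertex d)} (he : IsNNEdge e) :
    LipschitzOnWith ((ballEdges d (n + 1)).ncard : NNReal)
      (fun p => (P {U | pPivotal κ n p e U}).toReal) (Set.Icc 0 1) := by
  have := hP.1
  refine LipschitzOnWith.of_le_add_mul _ fun p hp q hq => ?_
  have h := ENNReal.toReal_mono (by finiteness) (measure_pPivotal_le (κ := κ) (n := n) hP he p hq)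
  rwa [ENNReal.toReal_add (by finiteness) (by finiteness), ENNReal.toReal_mul,
    ENNReal.toReal_ofReal (abs_nonneg _), ENNReal.toReal_natCast] at h

/-- For fixed `n ≥ 1`, only finitely many edges have positive probability of being
`p`-pivotal for `E_n(p)`, and `p ↦ Σ_{e ∈ 𝓔} ℙ(e is p-pivotal)` is continuous on `[0,1)`. -/
theorem pivotal_sum_finite_and_continuous (d κ : ℕ) (hd : 2 ≤ d) (hκ₁ : 2 ≤ κ)
    (hκ₂ : κ ≤ 2 * d) (P : Measure (Config d)) (hP : IsProductUniform P)
    (n : ℕ) (hn : 1 ≤ n) :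
    (∀ p ∈ Set.Icc (0 : ℝ) 1,
      {e : Sym2 (Vertex d) | IsNNEdge e ∧ P {U | pPivotal κ n p e U} ≠ 0}.Finite) ∧
    ContinuousOn (fun p => ∑' e : {e : Sym2 (Vertex d) // IsNNEdge e},
      (P {U | pPivotal κ n p e.1 U}).toReal) (Set.Ico (0 : ℝ) 1) := by
  have hempty : ∀ p e, IsNNEdge e → e ∉ ballEdges d n → P {U | pPivotal κ n p e U} = 0 := by
    intro p e he hmem
    rw [show {U | pPivotal κ n p e U} = ∅ from
      Set.eq_empty_of_forall_notMem fun U hU => hmem (hU.mem_ballEdges he), measure_empty]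
  refine ⟨fun p _ => (finite_ballEdges d n).subset fun e he => ?_, ?_⟩
  · by_contra hmem
    exact he.2 (hempty p e he.1 hmem)
  · have hfin : {e : {e : Sym2 (Vertex d) // IsNNEdge e} | e.1 ∈ ballEdges d n}.Finite :=
      (finite_ballEdges d n).preimage Subtype.val_injective.injOn
    have hsum : ∀ p, ∑' e : {e : Sym2 (Vertex d) // IsNNEdge e},
        (P {U | pPivotal κ n p e.1 U}).toReal =
        ∑ e ∈ hfin.toFinset, (P {U | pPivotal κ n p e.1 U}).toReal := fun p =>
      tsum_eq_sum fun e he => by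
        rw [hempty p e.1 e.2 (fun h => he (hfin.mem_toFinset.2 h)), ENNReal.toReal_zero]
    simp only [hsum]
    exact continuousOn_finsetSum _ fun e _ =>
      (lipschitzOnWith_measure_pPivotal κ n hP e.2).continuousOn.mono Set.Ico_subset_Icc_self

end CDP
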